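/- arXiv:1702.07584 — 2 statements merged into one kernel-verified Lean document; each statement's English description precedes it below -/
import Mathlib

section
/- Let n ≥ 1, β ≥ n, and let M be a positive semidefinite symmetric n×n real matrix. Then β − β·det(M)^{1/β} + tr(M − I) ≥ (3/(64β))·(1 − n/β)²·𝓕(‖M − I‖_HS), where ‖·‖_HS denotes the Hilbert–Schmidt (Frobenius) norm. -/
open Matrix

/-- `𝓕 t = t - log (1 + t)`. -/
noncomputable def sF (t : ℝ) : ℝ := t - Real.log (1 + t)

/-- Weighted AM-GM applied to the square roots, completed by the variable `1`. -/
theorem prod_rpow_inv_le_sq {n : ℕ} {β : ℝ} (hβ0 : 0 < β) (hβ : (n : ℝ) ≤ β)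
    (z : Fin n → ℝ) (hz : ∀ i, 0 ≤ z i) :
    (∏ i, z i ^ 2) ^ (1 / β) ≤ (1 + (∑ i, (z i - 1)) / β) ^ 2 := by
  have h1 : (n : ℝ) / β ≤ 1 := (div_le_one hβ0).2 hβ
  have h := Real.geom_mean_le_arith_mean_weighted (Finset.univ : Finset (Option (Fin n)))
    (fun o => o.elim (1 - n / β) (fun _ => 1 / β)) (fun o => o.elim 1 z)
    (by
      rintro (_ | i) _
      · exact sub_nonneg.2 h1
      · exact (one_div_pos.2 hβ0).le)
    (by simp [Fintype.sum_option]; ring)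
    (by
      rintro (_ | i) _
      · exact zero_le_one
      · exact hz i)
  simp only [Fintype.sum_option, Fintype.prod_option, Option.elim, Real.one_rpow, one_mul,
    ← Finset.mul_sum, mul_one] at h
  rw [Real.finsetProd_rpow _ _ (fun i _ => hz i)] at h
  have h0 : 0 ≤ (∏ i, z i) ^ (1 / β) := Real.rpow_nonneg (Finset.prod_nonneg fun i _ => hz i) _
  have h2 := pow_le_pow_left₀ h0 h 2
  have h3 : (∏ i, z i ^ 2) ^ (1 / β) = ((∏ i, z i) ^ (1 / β)) ^ 2 := by
    rw [Finset.prod_pow, Real.rpow_pow_comm (Finset.prod_nonneg fun i _ => hz i)]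
  rw [h3]
  refine h2.trans_eq ?_
  simp only [Finset.sum_sub_distrib, Finset.sum_const, Finset.card_univ, Fintype.card_fin,
    nsmul_eq_mul, mul_one]
  ring

/-- The deficit in the weighted AM-GM inequality controls the distance of the square roots to `1`. -/
theorem one_sub_div_mul_sum_sq_le {n : ℕ} {β : ℝ} (hβ0 : 0 < β) (hβ : (n : ℝ) ≤ β)
    (z : Fin n → ℝ) (hz : ∀ i, 0 ≤ z i) :
    (1 - n / β) * ∑ i, (z i - 1) ^ 2 ≤
      β - β * (∏ i, z i ^ 2) ^ (1 / β) + (∑ i, z i ^ 2 - n) := by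
  have h := mul_le_mul_of_nonneg_left (prod_rpow_inv_le_sq hβ0 hβ z hz) hβ0.le
  have hcs : (∑ i, (z i - 1)) ^ 2 ≤ n * ∑ i, (z i - 1) ^ 2 := by
    simpa using sq_sum_le_card_mul_sum_sq (s := Finset.univ) (f := fun i => z i - 1)
  have hsum : ∑ i, z i ^ 2 - n = ∑ i, (z i - 1) ^ 2 + 2 * ∑ i, (z i - 1) := by
    rw [Finset.mul_sum, ← Finset.sum_add_distrib, sub_eq_iff_eq_add]
    have : (n : ℝ) = ∑ _i : Fin n, (1 : ℝ) := by simp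
    rw [this, ← Finset.sum_add_distrib]
    exact Finset.sum_congr rfl fun i _ => by ring
  rw [hsum]
  generalize ∑ i, (z i - 1) = A at *
  generalize ∑ i, (z i - 1) ^ 2 = S at *
  have e : β * (1 + A / β) ^ 2 = β + 2 * A + A ^ 2 / β := by field_simp; ring
  have h4 : A ^ 2 / β ≤ n * S / β := div_le_div_of_nonneg_right hcs hβ0.le
  have e2 : (1 - n / β) * S = S - n * S / β := by ring
  linarith

theorem sF_nonneg {t : ℝ} (ht : 0 ≤ t) : 0 ≤ sF t := by
  have := Real.log_le_sub_one_of_pos (show 0 < 1 + t by linarith)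
  unfold sF
  linarith

theorem sF_le_of_le {t r : ℝ} (ht : 0 ≤ t) (hr : 0 ≤ r) (h : t ≤ r * (r + 2)) :
    sF t ≤ 4 * r ^ 2 := by
  have hpos : 0 < 1 + t := by linarith
  have h1 := Real.one_sub_inv_le_log_of_pos hpos
  have h2 : t - (1 - (1 + t)⁻¹) ≤ 4 * r ^ 2 := by
    have e : t - (1 - (1 + t)⁻¹) = t ^ 2 / (1 + t) := by field_simp; ring
    rw [e, div_le_iff₀ hpos]
    rcases le_total t (2 * r) with h3 | h3
    · nlinarith [mul_nonneg (sq_nonneg r) ht]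
    · nlinarith [mul_nonneg (sq_nonneg r) ht, mul_nonneg (sub_nonneg.2 h3) (sub_nonneg.2 h),
        mul_nonneg (sq_nonneg r) (sub_nonneg.2 h3), mul_nonneg hr (sub_nonneg.2 h3)]
  unfold sF
  linarith

theorem sF_sqrt_sum_le {n : ℕ} (z : Fin n → ℝ) (hz : ∀ i, 0 ≤ z i) :
    sF (Real.sqrt (∑ i, (z i ^ 2 - 1) ^ 2)) ≤ 4 * ∑ i, (z i - 1) ^ 2 := by
  have hS : 0 ≤ ∑ i, (z i - 1) ^ 2 := Finset.sum_nonneg fun i _ => sq_nonneg _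
  obtain ⟨r, hr, hrS⟩ : ∃ r : ℝ, 0 ≤ r ∧ r ^ 2 = ∑ i, (z i - 1) ^ 2 :=
    ⟨_, Real.sqrt_nonneg _, Real.sq_sqrt hS⟩
  rw [← hrS]
  refine sF_le_of_le (Real.sqrt_nonneg _) hr (Real.sqrt_le_iff.2 ⟨by positivity, ?_⟩)
  rw [mul_pow, hrS, Finset.sum_mul]
  refine Finset.sum_le_sum fun i hi => ?_
  have h1 : (z i - 1) ^ 2 ≤ r ^ 2 := hrS ▸ Finset.single_le_sum
    (f := fun i => (z i - 1) ^ 2) (fun i _ => sq_nonneg _) hi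
  have h2 : z i - 1 ≤ r := (abs_le_of_sq_le_sq' h1 hr).2
  have e : (z i ^ 2 - 1) ^ 2 = (z i - 1) ^ 2 * (z i + 1) ^ 2 := by ring
  rw [e]
  refine mul_le_mul_of_nonneg_left ?_ (sq_nonneg _)
  exact pow_le_pow_left₀ (by linarith [hz i]) (by linarith) 2

theorem trace_mul_self_eq_sum_eigenvalues_sq {n : ℕ} {M : Matrix (Fin n) (Fin n) ℝ}
    (hM : M.IsHermitian) : (M * M).trace = ∑ i, hM.eigenvalues i ^ 2 := by
  conv_lhs => rw [hM.spectral_theorem]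
  rw [← map_mul, Unitary.conjStarAlgAut_apply, Matrix.trace_mul_cycle]
  simp [Matrix.diagonal_mul_diagonal, Matrix.trace_diagonal, sq]

theorem sum_sub_one_sq_eq_sum_eigenvalues {n : ℕ} {M : Matrix (Fin n) (Fin n) ℝ}
    (hM : M.IsHermitian) :
    ∑ i, ∑ j, ((M - 1) i j) ^ 2 = ∑ i, (hM.eigenvalues i - 1) ^ 2 := by
  have hs : (M - 1)ᵀ = M - 1 := by
    rw [Matrix.transpose_sub, Matrix.transpose_one, ← Matrix.conjTranspose_eq_transpose_of_trivial,
      hM.eq]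
  have h1 : ∑ i, ∑ j, ((M - 1) i j) ^ 2 = ((M - 1) * (M - 1)).trace := by
    conv_rhs => rw [← hs]
    nth_rewrite 2 [hs]
    simp only [Matrix.trace, Matrix.diag_apply, Matrix.mul_apply, Matrix.transpose_apply, ← sq]
    exact Finset.sum_comm
  have h2 : (M - 1) * (M - 1) = M * M - M - M + 1 := by noncomm_ring
  have h3 : M.trace = ∑ i, hM.eigenvalues i := by simpa using hM.trace_eq_sum_eigenvalues
  rw [h1, h2, Matrix.trace_add, Matrix.trace_sub, Matrix.trace_sub, Matrix.trace_one,
    trace_mul_self_eq_sum_eigenvalues_sq hM, h3]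
  have : ((Fintype.card (Fin n) : ℕ) : ℝ) = ∑ _i : Fin n, (1 : ℝ) := by simp
  rw [this, ← Finset.sum_sub_distrib, ← Finset.sum_sub_distrib, ← Finset.sum_add_distrib]
  exact Finset.sum_congr rfl fun i _ => by ring

/-- for `n ≥ 1`, `β ≥ n` and `M` a positive semidefinite symmetric `n × n`
real matrix,
`β - β * det M ^ (1/β) + tr (M - I) ≥ (3/(64β)) * (1 - n/β)^2 * 𝓕(‖M - I‖_HS)`. -/
theorem quantitative_det_trace_case2 (n : ℕ) (hn : 1 ≤ n) (β : ℝ) (hβ : (n : ℝ) ≤ β)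
    (M : Matrix (Fin n) (Fin n) ℝ) (hM : M.PosSemidef) :
    β - β * M.det ^ (1 / β) + (M - 1).trace ≥
      (3 / (64 * β)) * (1 - n / β) ^ 2 *
        sF (Real.sqrt (∑ i, ∑ j, ((M - 1) i j) ^ 2)) := by
  have hβ1 : 1 ≤ β := le_trans (by exact_mod_cast hn) hβ
  have hβ0 : 0 < β := by linarith
  obtain ⟨z, hz, hzl⟩ : ∃ z : Fin n → ℝ, (∀ i, 0 ≤ z i) ∧
      ∀ i, hM.isHermitian.eigenvalues i = z i ^ 2 :=
    ⟨fun i => Real.sqrt (hM.isHermitian.eigenvalues i), fun i => Real.sqrt_nonneg _,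
      fun i => (Real.sq_sqrt (hM.eigenvalues_nonneg i)).symm⟩
  have hdet : M.det = ∏ i, z i ^ 2 := by
    simpa [hzl] using hM.isHermitian.det_eq_prod_eigenvalues
  have htr : (M - 1).trace = ∑ i, z i ^ 2 - n := by
    have : M.trace = ∑ i, z i ^ 2 := by
      simpa [hzl] using hM.isHermitian.trace_eq_sum_eigenvalues
    simp [Matrix.trace_sub, Matrix.trace_one, this]
  rw [hdet, htr, sum_sub_one_sq_eq_sum_eigenvalues hM.isHermitian]
  simp only [hzl]
  have hmain := one_sub_div_mul_sum_sq_le hβ0 hβ z hz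
  have hF := sF_sqrt_sum_le z hz
  have hF0 := sF_nonneg (Real.sqrt_nonneg (∑ i, (z i ^ 2 - 1) ^ 2))
  refine le_trans ?_ hmain
  have hq0 : 0 ≤ 1 - n / β := sub_nonneg.2 ((div_le_one hβ0).2 hβ)
  have hq1 : 1 - n / β ≤ 1 := sub_le_self _ (by positivity)
  have hc : 3 / (64 * β) ≤ 1 / 4 := by
    rw [div_le_div_iff₀ (by positivity) (by norm_num)]
    linarith
  calc 3 / (64 * β) * (1 - n / β) ^ 2 * sF (Real.sqrt (∑ i, (z i ^ 2 - 1) ^ 2))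
      ≤ 1 / 4 * (1 - n / β) * (4 * ∑ i, (z i - 1) ^ 2) := by
        gcongr
        nlinarith
    _ = (1 - n / β) * ∑ i, (z i - 1) ^ 2 := by ring
end

section
/- Let n ≥ 1, β > 0, and let W : ℝⁿ → [0,∞) be concave on its support Ω = {W > 0}, a bounded open convex set, C² on Ω, with ∫ W^β = 1, and suppose the Hessian D²W(x) is negative definite for every x ∈ Ω; set ρ_{β,W} = W^β. Then for every C¹ compactly supported (in Ω) function g with ∫ g ρ_{β,W} = 0, setting f = g·W, one has ∫ ⟨(−D²W)^{-1}∇f, ∇f⟩ ρ_{β,W} ≥ β·∫ g²·W·ρ_{β,W}. -/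
open MeasureTheory
open scoped RealInnerProductSpace

section BrascampLieb

open Set Filter Topology ENNReal

section PrekopaLeindler

/-- One-dimensional Brunn–Minkowski inequality, in midpoint form. -/
theorem volume_add_le_two_mul_of_midpoint_mem {A B D : Set ℝ} (hA : MeasurableSet A)
    (hB : MeasurableSet B) (hA' : A.Nonempty) (hB' : B.Nonempty)
    (h : ∀ x ∈ A, ∀ y ∈ B, (2⁻¹ : ℝ) * (x + y) ∈ D) :
    volume A + volume B ≤ 2 * volume D := by
  obtain ⟨a₀, ha₀⟩ := hA'
  obtain ⟨b₀, hb₀⟩ := hB'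
  have key : ∀ K L : Set ℝ, K ⊆ A → L ⊆ B → IsCompact K → IsCompact L →
      volume K + volume L ≤ 2 * volume D := by
    intro K₀ L₀ hK₀ hL₀ hK₀c hL₀c
    refine (add_le_add (measure_mono (subset_insert a₀ K₀))
      (measure_mono (subset_insert b₀ L₀))).trans ?_
    have hK := insert_subset ha₀ hK₀
    have hL := insert_subset hb₀ hL₀
    have hKc := hK₀c.insert a₀
    have hLc := hL₀c.insert b₀
    generalize hKe : insert a₀ K₀ = K at hK hKc
    generalize hLe : insert b₀ L₀ = L at hL hLc
    have hKn : K.Nonempty := hKe ▸ insert_nonempty _ _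
    have hLn : L.Nonempty := hLe ▸ insert_nonempty _ _
    obtain ⟨a, haK, ha⟩ := hKc.exists_isGreatest hKn
    obtain ⟨b, hbL, hb⟩ := hLc.exists_isLeast hLn
    have hD : volume ((fun x : ℝ => 2⁻¹ * x) ⁻¹' D) = 2 * volume D := by
      rw [Real.volume_preimage_mul_left (by norm_num)]
      norm_num
    rw [← hD, ← measure_preimage_add_right volume (-b) K, ← measure_preimage_add volume (-a) L,
      ← measure_union_add_inter _ ((measurable_const_add (-a)) hLc.measurableSet)]
    have hz : volume ((fun h => h + -b) ⁻¹' K ∩ (fun h => -a + h) ⁻¹' L) = 0 := by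
      refine measure_mono_null (t := {a + b}) ?_ (by simp)
      rintro z ⟨hz1, hz2⟩
      have h1 := ha hz1
      have h2 := hb hz2
      simp only [mem_singleton_iff]
      linarith
    rw [hz, add_zero]
    refine measure_mono ?_
    rintro z (hz | hz)
    · have := h _ (hK hz) b (hL hbL)
      simpa using this
    · have := h a (hK haK) _ (hL hz)
      simpa using this
  rw [hA.measure_eq_iSup_isCompact, hB.measure_eq_iSup_isCompact]
  have hne : ∀ S : Set ℝ, Nonempty {K : Set ℝ // K ⊆ S ∧ IsCompact K} :=
    fun S => ⟨⟨∅, empty_subset _, isCompact_empty⟩⟩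
  have hsup : ∀ S : Set ℝ, (⨆ K, ⨆ (_ : K ⊆ S), ⨆ (_ : IsCompact K), volume K) =
      ⨆ K : {K : Set ℝ // K ⊆ S ∧ IsCompact K}, volume K.1 := by
    intro S
    simp only [iSup_subtype, iSup_and]
  rw [hsup, hsup]
  have := hne A
  have := hne B
  exact ENNReal.iSup_add_iSup_le fun K L => key _ _ K.2.1 L.2.1 K.2.2 L.2.2

theorem lintegral_add_le_of_min_le_of_iSup_eq_one {A B C : ℝ → ℝ≥0∞} (hA : Measurable A)
    (hB : Measurable B) (hC : Measurable C) (hA1 : ⨆ x, A x = 1) (hB1 : ⨆ x, B x = 1)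
    (h : ∀ x y, min (A x) (B y) ≤ C ((2⁻¹ : ℝ) * (x + y))) :
    (∫⁻ x, A x) + ∫⁻ x, B x ≤ 2 * ∫⁻ x, C x := by
  have hAle : ∀ x, A x ≤ 1 := fun x => hA1 ▸ le_iSup A x
  have hBle : ∀ x, B x ≤ 1 := fun x => hB1 ▸ le_iSup B x
  have cake : ∀ F : ℝ → ℝ≥0∞, Measurable F → (∀ x, F x ≤ 1) →
      ∫⁻ x, F x = ∫⁻ t in Ioi (0 : ℝ), volume {x | ENNReal.ofReal t < F x} := by
    intro F hF hF1
    have hfin : ∀ x, F x ≠ ∞ := fun x => ((hF1 x).trans_lt one_lt_top).ne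
    have := lintegral_eq_lintegral_meas_lt (μ := (volume : Measure ℝ)) (f := fun x => (F x).toReal)
      (Eventually.of_forall fun x => toReal_nonneg) hF.ennreal_toReal.aemeasurable
    simp only [ofReal_toReal (hfin _)] at this
    rw [this]
    refine setLIntegral_congr_fun measurableSet_Ioi fun t ht => ?_
    simp only [ENNReal.ofReal_lt_iff_lt_toReal (le_of_lt ht) (hfin _)]
  have hC' : ∫⁻ x, min (C x) 1 ≤ ∫⁻ x, C x := lintegral_mono fun x => min_le_left _ _
  refine le_trans ?_ (mul_le_mul_right hC' 2)
  rw [cake A hA hAle, cake B hB hBle,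
    cake (fun x => min (C x) 1) (hC.min measurable_const) fun x => min_le_right _ _,
    ← lintegral_const_mul' _ _ (by norm_num)]
  refine (le_lintegral_add _ _).trans (lintegral_mono fun t => ?_)
  rcases lt_or_ge (ENNReal.ofReal t) 1 with ht | ht
  · refine volume_add_le_two_mul_of_midpoint_mem (measurableSet_lt measurable_const hA)
      (measurableSet_lt measurable_const hB) ?_ ?_ ?_
    · exact lt_iSup_iff.1 (hA1 ▸ ht)
    · exact lt_iSup_iff.1 (hB1 ▸ ht)
    · intro x hx y hy
      exact lt_min ((lt_min hx hy).trans_le (h x y)) ht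
  · have e : ∀ F : ℝ → ℝ≥0∞, (∀ x, F x ≤ 1) → {x | ENNReal.ofReal t < F x} = ∅ := by
      intro F hF
      ext x
      simpa using (hF x).trans ht
    rw [e A hAle, e B hBle]
    simp

theorem ENNReal.mul_le_sq_of_add_le_two_mul {a b c : ℝ≥0∞} (h : a + b ≤ 2 * c) :
    a * b ≤ c ^ 2 := by
  rcases eq_or_ne c ∞ with rfl | hc
  · simp
  have hab : a + b ≠ ∞ := (h.trans_lt (mul_lt_top (by norm_num) hc.lt_top)).ne
  lift c to NNReal using hc
  lift a to NNReal using (add_ne_top.1 hab).1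
  lift b to NNReal using (add_ne_top.1 hab).2
  norm_cast at h ⊢
  have h' : (a : ℝ) + b ≤ 2 * c := by exact_mod_cast h
  have : (a : ℝ) * b ≤ c ^ 2 := by
    nlinarith [sq_nonneg ((a : ℝ) - b), a.2, b.2, c.2, NNReal.coe_nonneg a, NNReal.coe_nonneg b]
  exact_mod_cast this

/-- The midpoint Prékopa–Leindler inequality holds for the measure `μ`. -/
def PrekopaLeindler {E : Type*} [AddCommGroup E] [Module ℝ E] [MeasurableSpace E]
    (μ : Measure E) : Prop :=
  ∀ A B C : E → ℝ≥0∞, Measurable A → Measurable B → Measurable C →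
    (∀ x y, A x * B y ≤ C ((2⁻¹ : ℝ) • (x + y)) ^ 2) →
    (∫⁻ x, A x ∂μ) * ∫⁻ x, B x ∂μ ≤ (∫⁻ x, C x ∂μ) ^ 2

theorem prekopaLeindler_real_of_bounded {A B C : ℝ → ℝ≥0∞} (hA : Measurable A)
    (hB : Measurable B) (hC : Measurable C) (hA1 : ⨆ x, A x ≠ ∞) (hB1 : ⨆ x, B x ≠ ∞)
    (h : ∀ x y, A x * B y ≤ C ((2⁻¹ : ℝ) * (x + y)) ^ 2) :
    (∫⁻ x, A x) * ∫⁻ x, B x ≤ (∫⁻ x, C x) ^ 2 := by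
  have hzero : ∀ F : ℝ → ℝ≥0∞, ⨆ x, F x = 0 → ∫⁻ x, F x = 0 := by
    intro F hF
    have : F = 0 := by
      funext x
      exact le_antisymm (hF.le.trans' (le_iSup F x)) bot_le
    simp [this]
  rcases eq_or_ne (⨆ x, A x) 0 with ha0 | ha0
  · simp [hzero A ha0]
  rcases eq_or_ne (⨆ x, B x) 0 with hb0 | hb0
  · simp [hzero B hb0]
  set a := ⨆ x, A x with ha
  set b := ⨆ x, B x with hb
  obtain ⟨s, hs⟩ : ∃ s : ℝ≥0∞, s ^ 2 = a * b := by
    refine ⟨(a * b) ^ (1 / 2 : ℝ), ?_⟩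
    rw [← ENNReal.rpow_natCast, ← ENNReal.rpow_mul]
    norm_num
  have hs0 : s ≠ 0 := by
    rintro rfl
    simp [ha0, hb0] at hs
  have hst : s ≠ ∞ := by
    rintro rfl
    exact mul_ne_top hA1 hB1 (by simpa using hs.symm)
  have key := lintegral_add_le_of_min_le_of_iSup_eq_one (A := fun x => a⁻¹ * A x)
    (B := fun x => b⁻¹ * B x) (C := fun x => s⁻¹ * C x) (hA.const_mul _) (hB.const_mul _)
    (hC.const_mul _) (by rw [← ENNReal.mul_iSup, ENNReal.inv_mul_cancel ha0 hA1])
    (by rw [← ENNReal.mul_iSup, ENNReal.inv_mul_cancel hb0 hB1]) (by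
      intro x y
      have h1 : (min (a⁻¹ * A x) (b⁻¹ * B y)) ^ 2 ≤ (s⁻¹ * C (2⁻¹ * (x + y))) ^ 2 := by
        calc (min (a⁻¹ * A x) (b⁻¹ * B y)) ^ 2 ≤ (a⁻¹ * A x) * (b⁻¹ * B y) := by
              rw [sq]; exact mul_le_mul' (min_le_left _ _) (min_le_right _ _)
          _ = (a * b)⁻¹ * (A x * B y) := by
              rw [ENNReal.mul_inv (Or.inl ha0) (Or.inl hA1)]; ring
          _ ≤ (s ^ 2)⁻¹ * C (2⁻¹ * (x + y)) ^ 2 := by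
              rw [hs]; exact mul_le_mul_right (h x y) _
          _ = _ := by rw [mul_pow, ENNReal.inv_pow]
      exact (ENNReal.pow_le_pow_left_iff two_ne_zero).1 h1)
  have key2 := ENNReal.mul_le_sq_of_add_le_two_mul key
  rw [lintegral_const_mul _ hA, lintegral_const_mul _ hB, lintegral_const_mul _ hC] at key2
  calc (∫⁻ x, A x) * ∫⁻ x, B x
      = (a * a⁻¹) * (b * b⁻¹) * ((∫⁻ x, A x) * ∫⁻ x, B x) := by
        rw [ENNReal.mul_inv_cancel ha0 hA1, ENNReal.mul_inv_cancel hb0 hB1]; simp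
    _ = a * b * ((a⁻¹ * ∫⁻ x, A x) * (b⁻¹ * ∫⁻ x, B x)) := by ring
    _ ≤ s ^ 2 * (s⁻¹ * ∫⁻ x, C x) ^ 2 := by rw [hs]; exact mul_le_mul_right key2 _
    _ = (s * s⁻¹) ^ 2 * (∫⁻ x, C x) ^ 2 := by ring
    _ = _ := by rw [ENNReal.mul_inv_cancel hs0 hst]; simp

theorem prekopaLeindler_real : PrekopaLeindler (volume : Measure ℝ) := by
  intro A B C hA hB hC h
  have trunc : ∀ F : ℝ → ℝ≥0∞, Measurable F →
      ∫⁻ x, F x = ⨆ N : ℕ, ∫⁻ x, min (F x) N := by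
    intro F hF
    rw [← lintegral_iSup (fun N => hF.min measurable_const)
      (fun N M hNM x => min_le_min_left _ (by exact_mod_cast hNM))]
    congr with x
    rw [← inf_iSup_eq, ENNReal.iSup_natCast, inf_top_eq]
  have hb : ∀ (F : ℝ → ℝ≥0∞) (N : ℕ), ⨆ x, min (F x) N ≠ ∞ := fun F N =>
    ((iSup_le fun x => min_le_right _ _).trans_lt (natCast_lt_top N)).ne
  rw [trunc A hA, trunc B hB, ENNReal.iSup_mul]
  refine iSup_le fun N => ?_
  rw [ENNReal.mul_iSup]
  refine iSup_le fun M => ?_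
  exact prekopaLeindler_real_of_bounded (hA.min measurable_const) (hB.min measurable_const) hC
    (hb A N) (hb B M) fun x y => (mul_le_mul' (min_le_left _ _) (min_le_left _ _)).trans (h x y)

theorem PrekopaLeindler.prod {E F : Type*} [AddCommGroup E] [Module ℝ E] [MeasurableSpace E]
    [AddCommGroup F] [Module ℝ F] [MeasurableSpace F] {μ : Measure E} {ν : Measure F}
    [SFinite ν] (hμ : PrekopaLeindler μ) (hν : PrekopaLeindler ν) :
    PrekopaLeindler (μ.prod ν) := by
  intro A B C hA hB hC h
  rw [lintegral_prod _ hA.aemeasurable, lintegral_prod _ hB.aemeasurable,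
    lintegral_prod _ hC.aemeasurable]
  refine hμ _ _ _ hA.lintegral_prod_right' hB.lintegral_prod_right' hC.lintegral_prod_right' ?_
  intro x y
  exact hν _ _ _ (hA.comp measurable_prodMk_left) (hB.comp measurable_prodMk_left)
    (hC.comp measurable_prodMk_left) fun u v => h (x, u) (y, v)

theorem PrekopaLeindler.of_measurePreserving {E F : Type*} [AddCommGroup E] [Module ℝ E]
    [MeasurableSpace E] [AddCommGroup F] [Module ℝ F] [MeasurableSpace F] {μ : Measure E}
    {ν : Measure F} (hμ : PrekopaLeindler μ) (e : E ≃ᵐ F) (he : MeasurePreserving e μ ν)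
    (hlin : ∀ x y, e ((2⁻¹ : ℝ) • (x + y)) = (2⁻¹ : ℝ) • (e x + e y)) :
    PrekopaLeindler ν := by
  intro A B C hA hB hC h
  rw [← he.lintegral_comp hA, ← he.lintegral_comp hB, ← he.lintegral_comp hC]
  refine hμ _ _ _ (hA.comp e.measurable) (hB.comp e.measurable) (hC.comp e.measurable) ?_
  intro x y
  simpa only [Function.comp, hlin] using h (e x) (e y)

theorem prekopaLeindler_pi (n : ℕ) : PrekopaLeindler (volume : Measure (Fin n → ℝ)) := by
  induction n with
  | zero =>
    intro A B C _ _ _ h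
    have hv : ∀ F : (Fin 0 → ℝ) → ℝ≥0∞, ∫⁻ x, F x = F 0 := by
      intro F
      rw [Measure.volume_pi_eq_dirac 0, lintegral_dirac]
    rw [hv, hv, hv]
    have := h 0 0
    simpa using this
  | succ n ih =>
    have hp : PrekopaLeindler (volume : Measure (ℝ × (Fin n → ℝ))) := prekopaLeindler_real.prod ih
    refine hp.of_measurePreserving (MeasurableEquiv.piFinSuccAbove (fun _ => ℝ) 0).symm
      (volume_preserving_piFinSuccAbove (fun _ => ℝ) 0).symm ?_
    intro x y
    ext i
    refine Fin.cases ?_ (fun i => ?_) i <;>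
      simp [MeasurableEquiv.piFinSuccAbove, mul_add]

theorem prekopaLeindler_euclideanSpace (n : ℕ) :
    PrekopaLeindler (volume : Measure (EuclideanSpace ℝ (Fin n))) :=
  (prekopaLeindler_pi n).of_measurePreserving (MeasurableEquiv.toLp 2 (Fin n → ℝ))
    (EuclideanSpace.volume_preserving_symm_measurableEquiv_toLp (Fin n)).symm fun _ _ => rfl

end PrekopaLeindler

section Hessian

variable {E : Type*} [NormedAddCommGroup E] [InnerProductSpace ℝ E]

theorem ContDiffAt.gradient_right [CompleteSpace E] {W : E → ℝ} {z : E} {m n : WithTop ℕ∞}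
    (hW : ContDiffAt ℝ n W z) (hmn : m + 1 ≤ n) : ContDiffAt ℝ m (gradient W) z := by
  let J : StrongDual ℝ E →L[ℝ] E :=
    { toFun := fun l => (InnerProductSpace.toDual ℝ E).symm l
      map_add' := fun a b => map_add _ a b
      map_smul' := fun a b => by simp
      cont := (InnerProductSpace.toDual ℝ E).symm.continuous }
  exact J.contDiff.contDiffAt.comp z (hW.fderiv_right hmn)

theorem inner_fderiv_gradient [CompleteSpace E] {W : E → ℝ} {z : E} (hW : ContDiffAt ℝ 2 W z)
    (v w : E) : ⟪fderiv ℝ (gradient W) z v, w⟫ = fderiv ℝ (fderiv ℝ W) z v w := by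
  have hg : HasFDerivAt (gradient W) (fderiv ℝ (gradient W) z) z :=
    ((hW.gradient_right (m := 1) (by norm_num)).differentiableAt one_ne_zero).hasFDerivAt
  have hf : HasFDerivAt (fderiv ℝ W) (fderiv ℝ (fderiv ℝ W) z) z :=
    ((hW.fderiv_right (m := 1) (by norm_num)).differentiableAt one_ne_zero).hasFDerivAt
  have h1 : HasFDerivAt (fun y => ⟪gradient W y, w⟫) _ z := hg.inner ℝ (hasFDerivAt_const w z)
  have h2 : HasFDerivAt (fun y => fderiv ℝ W y w) _ z := hf.clm_apply (hasFDerivAt_const w z)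
  simp only [inner_gradient_left] at h1
  simpa using DFunLike.congr_fun (h1.unique h2) v

theorem inner_fderiv_gradient_comm [CompleteSpace E] {W : E → ℝ} {z : E}
    (hW : ContDiffAt ℝ 2 W z) (v w : E) :
    ⟪fderiv ℝ (gradient W) z v, w⟫ = ⟪v, fderiv ℝ (gradient W) z w⟫ := by
  rw [inner_fderiv_gradient hW, real_inner_comm, inner_fderiv_gradient hW]
  exact hW.isSymmSndFDerivAt (by simp) v w

theorem isUnit_of_inner_pos [FiniteDimensional ℝ E] {A : E →L[ℝ] E}
    (hA : ∀ v, v ≠ 0 → 0 < ⟪A v, v⟫) : IsUnit A := by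
  have := FiniteDimensional.complete ℝ E
  rw [ContinuousLinearMap.isUnit_iff_bijective]
  have hinj : Function.Injective (A : E →ₗ[ℝ] E) := by
    rw [← LinearMap.ker_eq_bot, LinearMap.ker_eq_bot']
    intro v hv
    by_contra h
    have h' := hA v h
    rw [show A v = 0 from hv] at h'
    simp at h'
  exact ⟨hinj, LinearMap.injective_iff_surjective.1 hinj⟩

theorem apply_inverse_of_isUnit {A : E →L[ℝ] E} (hA : IsUnit A) (a : E) :
    A (Ring.inverse A a) = a := by
  rw [← mul_apply_eq_comp, Ring.mul_inverse_cancel A hA]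
  rfl

/-- The Fenchel–Young inequality for a positive definite quadratic form. -/
theorem two_mul_inner_sub_le_inner_inverse [FiniteDimensional ℝ E] {A : E →L[ℝ] E}
    (hA : ∀ v, v ≠ 0 → 0 < ⟪A v, v⟫) (hsymm : ∀ v w, ⟪A v, w⟫ = ⟪v, A w⟫) (a w : E) :
    2 * ⟪a, w⟫ - ⟪A w, w⟫ ≤ ⟪Ring.inverse A a, a⟫ := by
  set u := Ring.inverse A a with hu
  have hAu : A u = a := apply_inverse_of_isUnit (isUnit_of_inner_pos hA) a
  have hnn : 0 ≤ ⟪A (w - u), w - u⟫ := by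
    by_cases h : w - u = 0
    · simp [h]
    · exact (hA _ h).le
  rw [map_sub, hAu, inner_sub_left, inner_sub_right, inner_sub_right, hsymm w u, hAu,
    real_inner_comm a w, real_inner_comm u a] at hnn
  linarith

/-- Second order Taylor bound along a segment. -/
theorem le_tangent_sub_of_hessian_le [CompleteSpace E] {W : E → ℝ} {z w : E} {k : ℝ}
    (hW : ∀ t ∈ Icc (0 : ℝ) 1, ContDiffAt ℝ 2 W (z + t • w))
    (hk : ∀ t ∈ Icc (0 : ℝ) 1, ⟪fderiv ℝ (gradient W) (z + t • w) w, w⟫ ≤ -k) :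
    W (z + w) ≤ W z + ⟪gradient W z, w⟫ - k / 2 := by
  have hline : ∀ t : ℝ, HasDerivAt (fun t : ℝ => z + t • w) w t := fun t => by
    simpa using ((hasDerivAt_id t).smul_const w).const_add z
  have hd1 : ∀ t ∈ Icc (0 : ℝ) 1, HasDerivAt (fun t => W (z + t • w) -
      t * ⟪gradient W z, w⟫ + k * t ^ 2 / 2)
      (⟪gradient W (z + t • w), w⟫ - ⟪gradient W z, w⟫ + k * t) t := by
    intro t ht
    have h1 := ((hW t ht).differentiableAt two_ne_zero).hasFDerivAt.comp_hasDerivAt t (hline t)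
    have h2 := (hasDerivAt_id t).mul_const ⟪gradient W z, w⟫
    have h3 := (((hasDerivAt_id t).pow 2).const_mul k).div_const 2
    have h4 := (h1.sub h2).add h3
    refine h4.congr_deriv ?_
    simp
    ring
  have hd2 : ∀ t ∈ Icc (0 : ℝ) 1, HasDerivAt (fun t => ⟪gradient W (z + t • w), w⟫ -
      ⟪gradient W z, w⟫ + k * t)
      (⟪fderiv ℝ (gradient W) (z + t • w) w, w⟫ + k) t := by
    intro t ht
    have h1 := (((hW t ht).gradient_right (m := 1) (by norm_num)).differentiableAt
      one_ne_zero).hasFDerivAt.comp_hasDerivAt t (hline t)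
    have h2 := (h1.inner ℝ (hasDerivAt_const t w)).sub_const ⟪gradient W z, w⟫
    have h3 := (hasDerivAt_id t).const_mul k
    refine (h2.add h3).congr_deriv ?_
    simp
  have hanti2 := antitoneOn_of_hasDerivWithinAt_nonpos (convex_Icc (0 : ℝ) 1)
    (fun t ht => (hd2 t ht).continuousAt.continuousWithinAt)
    (fun t ht => (hd2 t (interior_subset ht)).hasDerivWithinAt)
    (fun t ht => by linarith [hk t (interior_subset ht)])
  have hanti1 := antitoneOn_of_hasDerivWithinAt_nonpos (convex_Icc (0 : ℝ) 1)
    (fun t ht => (hd1 t ht).continuousAt.continuousWithinAt)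
    (fun t ht => (hd1 t (interior_subset ht)).hasDerivWithinAt)
    (fun t ht => by
      have ht' := interior_subset ht
      have := hanti2 (left_mem_Icc.2 zero_le_one) ht' ht'.1
      simpa using this)
  have := hanti1 (left_mem_Icc.2 zero_le_one) (right_mem_Icc.2 zero_le_one) zero_le_one
  simp only [one_smul, zero_smul, add_zero] at this
  linarith

variable [CompleteSpace E] {Ω : Set E} {W : E → ℝ}

theorem le_tangent_of_hessian_nonpos (hΩo : IsOpen Ω) (hΩ : Convex ℝ Ω)
    (hW : ContDiffOn ℝ 2 W Ω)
    (hneg : ∀ x ∈ Ω, ∀ v : E, v ≠ 0 → ⟪fderiv ℝ (gradient W) x v, v⟫ < 0) {x z : E}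
    (hx : x ∈ Ω) (hz : z ∈ Ω) : W x ≤ W z + ⟪gradient W z, x - z⟫ := by
  have hmem : ∀ t ∈ Icc (0 : ℝ) 1, z + t • (x - z) ∈ Ω := fun t ht =>
    hΩ.add_smul_sub_mem hz hx ht
  have := le_tangent_sub_of_hessian_le (W := W) (z := z) (w := x - z) (k := 0)
    (fun t ht => hW.contDiffAt (hΩo.mem_nhds (hmem t ht))) (fun t ht => by
      by_cases h : x - z = 0
      · simp [h]
      · simpa using (hneg _ (hmem t ht) _ h).le)
  simpa using this

/-- The Bregman divergence of a concave function is superadditive along segments. -/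
theorem le_tangent_sub_of_between (hΩo : IsOpen Ω) (hΩ : Convex ℝ Ω) (hW : ContDiffOn ℝ 2 W Ω)
    (hneg : ∀ x ∈ Ω, ∀ v : E, v ≠ 0 → ⟪fderiv ℝ (gradient W) x v, v⟫ < 0) {x z : E}
    (hx : x ∈ Ω) (hz : z ∈ Ω) {s : ℝ} (hs0 : 0 ≤ s) (hs1 : s ≤ 1) {c₁ c₂ : ℝ}
    (h₁ : W (z + s • (x - z)) ≤ W z + ⟪gradient W z, s • (x - z)⟫ - c₁)
    (h₂ : W x ≤ W (z + s • (x - z)) +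
      ⟪gradient W (z + s • (x - z)), (1 - s) • (x - z)⟫ - c₂) :
    W x ≤ W z + ⟪gradient W z, x - z⟫ - (c₁ + c₂) := by
  set p := z + s • (x - z) with hp
  have hpΩ : p ∈ Ω := hΩ.add_smul_sub_mem hz hx ⟨hs0, hs1⟩
  have e1 := le_tangent_of_hessian_nonpos hΩo hΩ hW hneg hpΩ hz
  have e2 := le_tangent_of_hessian_nonpos hΩo hΩ hW hneg hz hpΩ
  rw [show p - z = s • (x - z) by rw [hp]; abel] at e1
  rw [show z - p = -(s • (x - z)) by rw [hp]; abel] at e2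
  simp only [inner_neg_right, inner_smul_right] at e1 e2 h₁ h₂
  have e3 : ⟪gradient W p, x - z⟫ ≤ ⟪gradient W z, x - z⟫ := by
    rcases hs0.eq_or_lt with rfl | hs0
    · simp [hp]
    have : s * ⟪gradient W p, x - z⟫ ≤ s * ⟪gradient W z, x - z⟫ := by linarith
    exact le_of_mul_le_mul_left this hs0
  have e4 := mul_le_mul_of_nonneg_left e3 (sub_nonneg.2 hs1)
  linarith

theorem continuousOn_fderiv_gradient (hΩo : IsOpen Ω) (hW : ContDiffOn ℝ 2 W Ω) :
    ContinuousOn (fderiv ℝ (gradient W)) Ω := by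
  have : ContDiffOn ℝ 1 (gradient W) Ω := fun x hx =>
    ((hW.contDiffAt (hΩo.mem_nhds hx)).gradient_right (by norm_num)).contDiffWithinAt
  exact this.continuousOn_fderiv_of_isOpen hΩo le_rfl

theorem exists_hessian_le_neg_sq [FiniteDimensional ℝ E] (hΩo : IsOpen Ω)
    (hW : ContDiffOn ℝ 2 W Ω)
    (hneg : ∀ x ∈ Ω, ∀ v : E, v ≠ 0 → ⟪fderiv ℝ (gradient W) x v, v⟫ < 0) {K : Set E}
    (hK : IsCompact K) (hKΩ : K ⊆ Ω) :
    ∃ m > 0, ∀ y ∈ K, ∀ v : E, ⟪fderiv ℝ (gradient W) y v, v⟫ ≤ -(m * ‖v‖ ^ 2) := by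
  have := FiniteDimensional.proper ℝ E
  have hcont : ContinuousOn (fun p : E × E => -⟪fderiv ℝ (gradient W) p.1 p.2, p.2⟫)
      (K ×ˢ Metric.sphere (0 : E) 1) := by
    have h1 : ContinuousOn (fun p : E × E => fderiv ℝ (gradient W) p.1)
        (K ×ˢ Metric.sphere (0 : E) 1) :=
      ((continuousOn_fderiv_gradient hΩo hW).mono hKΩ).comp continuousOn_fst fun p hp => hp.1
    exact ((h1.clm_apply continuousOn_snd).inner continuousOn_snd).neg
  obtain ⟨m, hm, hle⟩ := (hK.prod (isCompact_sphere (0 : E) 1)).exists_forall_le' hcont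
    (a := 0) (by
      rintro ⟨y, v⟩ ⟨hy, hv⟩
      have hv0 : v ≠ 0 := by
        rintro rfl
        simp at hv
      simpa using hneg y (hKΩ hy) v hv0)
  refine ⟨m, hm, fun y hy v => ?_⟩
  by_cases hv : v = 0
  · simp [hv]
  have hv' : ‖v‖ ≠ 0 := norm_ne_zero_iff.2 hv
  have := hle (y, ‖v‖⁻¹ • v) ⟨hy, by simp [norm_smul, hv']⟩
  simp only [map_smul, inner_smul_left, inner_smul_right, conj_trivial] at this
  have h2 := mul_le_mul_of_nonneg_right this (sq_nonneg ‖v‖)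
  field_simp at h2
  linarith

theorem le_tangent_sub_sq_of_far (hΩo : IsOpen Ω) (hΩ : Convex ℝ Ω) (hW : ContDiffOn ℝ 2 W Ω)
    (hneg : ∀ x ∈ Ω, ∀ v : E, v ≠ 0 → ⟪fderiv ℝ (gradient W) x v, v⟫ < 0)
    {K K' : Set E} {r m : ℝ} (hr : 0 < r) (hK' : K' ⊆ Ω)
    (hball : ∀ z ∈ K, Metric.closedBall z r ⊆ K')
    (hm : ∀ y ∈ K', ∀ v : E, ⟪fderiv ℝ (gradient W) y v, v⟫ ≤ -(m * ‖v‖ ^ 2)) {x z : E}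
    (hx : x ∈ Ω) (hz : z ∈ Ω) (hxz : r ≤ ‖x - z‖) (h : z ∈ K ∨ x ∈ K) :
    W x ≤ W z + ⟪gradient W z, x - z⟫ - m * r ^ 2 / 2 := by
  have hpos : 0 < ‖x - z‖ := hr.trans_le hxz
  set s := r / ‖x - z‖ with hs
  have hs0 : 0 < s := div_pos hr hpos
  have hs1 : s ≤ 1 := (div_le_one hpos).2 hxz
  have hsn : ‖s • (x - z)‖ = r := by
    rw [norm_smul, Real.norm_of_nonneg hs0.le, hs]
    field_simp
  have quad : ∀ p, (∀ t ∈ Icc (0 : ℝ) 1, p + t • s • (x - z) ∈ K') →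
      W (p + s • (x - z)) ≤ W p + ⟪gradient W p, s • (x - z)⟫ - m * r ^ 2 / 2 := by
    intro p hp
    refine le_tangent_sub_of_hessian_le
      (fun t ht => hW.contDiffAt (hΩo.mem_nhds (hK' (hp t ht)))) fun t ht => ?_
    have := hm _ (hp t ht) (s • (x - z))
    rwa [hsn] at this
  rcases h with h | h
  · have hp : z + s • (x - z) ∈ Ω := hΩ.add_smul_sub_mem hz hx ⟨hs0.le, hs1⟩
    have := le_tangent_sub_of_between hΩo hΩ hW hneg hx hz hs0.le hs1 (c₁ := m * r ^ 2 / 2)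
      (c₂ := 0) (quad z fun t ht => hball z h ?_) ?_
    · simpa using this
    · rw [mem_closedBall_iff_norm, add_sub_cancel_left, norm_smul, hsn,
        Real.norm_of_nonneg ht.1]
      nlinarith [ht.2]
    · have := le_tangent_of_hessian_nonpos hΩo hΩ hW hneg hx hp
      rw [show x - (z + s • (x - z)) = (1 - s) • (x - z) by module] at this
      simpa using this
  · have hs0' : 0 ≤ 1 - s := sub_nonneg.2 hs1
    have hs1' : 1 - s ≤ 1 := by linarith
    have hp : z + (1 - s) • (x - z) ∈ Ω := hΩ.add_smul_sub_mem hz hx ⟨hs0', hs1'⟩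
    have := le_tangent_sub_of_between hΩo hΩ hW hneg hx hz hs0' hs1' (c₁ := 0)
      (c₂ := m * r ^ 2 / 2) ?_ ?_
    · simpa using this
    · have := le_tangent_of_hessian_nonpos hΩo hΩ hW hneg hp hz
      simpa using this
    · have := quad (z + (1 - s) • (x - z)) fun t ht => hball x h ?_
      · rw [show z + (1 - s) • (x - z) + s • (x - z) = x by module] at this
        simpa using this
      · rw [mem_closedBall_iff_norm,
          show z + (1 - s) • (x - z) + t • s • (x - z) - x = (t - 1) • s • (x - z) by module,
          norm_smul, hsn, Real.norm_of_nonpos (by linarith [ht.2])]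
        nlinarith [ht.1, ht.2]

/-- Near the support of a perturbation `f`, the tangent plane of `W` lies above `W + ε f` up to a
second order term given by the inverse Hessian. -/
theorem exists_perturbed_tangent_bound [FiniteDimensional ℝ E] (hΩo : IsOpen Ω)
    (hΩ : Convex ℝ Ω) (hW : ContDiffOn ℝ 2 W Ω)
    (hneg : ∀ x ∈ Ω, ∀ v : E, v ≠ 0 → ⟪fderiv ℝ (gradient W) x v, v⟫ < 0) {f : E → ℝ}
    (hf : ContDiff ℝ 1 f) (hfs : HasCompactSupport f) (hfΩ : tsupport f ⊆ Ω) :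
    ∃ K, IsCompact K ∧ K ⊆ Ω ∧ ∀ η > 0, ∃ ε₀ > 0, ∀ ε : ℝ, |ε| < ε₀ → ∀ x ∈ Ω, ∀ z ∈ Ω,
      W x + ε * (f x - f z) ≤ W z + ⟪gradient W z, x - z⟫ + ε ^ 2 / 2 *
        (⟪Ring.inverse (-fderiv ℝ (gradient W) z) (gradient f z), gradient f z⟫ +
          K.indicator (fun _ => η) z) := by
  have := FiniteDimensional.proper ℝ E
  have hneg' : ∀ z ∈ Ω, ∀ v : E, v ≠ 0 → 0 < ⟪(-fderiv ℝ (gradient W) z) v, v⟫ := by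
    intro z hz v hv
    simpa using hneg z hz v hv
  have young : ∀ z ∈ Ω, ∀ a w : E, 2 * ⟪a, w⟫ + ⟪fderiv ℝ (gradient W) z w, w⟫ ≤
      ⟪Ring.inverse (-fderiv ℝ (gradient W) z) a, a⟫ := by
    intro z hz a w
    have := two_mul_inner_sub_le_inner_inverse (hneg' z hz) (fun v w => by
      simpa using inner_fderiv_gradient_comm (hW.contDiffAt (hΩo.mem_nhds hz)) v w) a w
    simpa using this
  have hq : ∀ z ∈ Ω, ∀ a : E, 0 ≤ ⟪Ring.inverse (-fderiv ℝ (gradient W) z) a, a⟫ := by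
    intro z hz a
    simpa using young z hz a 0
  obtain ⟨ρ, hρ, hρΩ⟩ := hfs.isCompact.exists_cthickening_subset_open hΩo hfΩ
  set S := tsupport f with hS
  set K := Metric.cthickening (ρ / 2) S with hKdef
  set K' := Metric.cthickening ρ S with hK'def
  have hK : IsCompact K := hfs.isCompact.cthickening
  have hK' : IsCompact K' := hfs.isCompact.cthickening
  have hKK' : K ⊆ K' := Metric.cthickening_mono (by linarith) _
  have hball : ∀ z ∈ K, Metric.closedBall z (ρ / 2) ⊆ K' := by
    intro z hz y hy
    have h1 : y ∈ Metric.cthickening (ρ / 2) K := Metric.mem_cthickening_of_dist_le y z _ _ hz hy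
    have h2 := Metric.cthickening_cthickening_subset (by positivity) (by positivity) S h1
    rwa [add_halves] at h2
  obtain ⟨m, hm0, hm⟩ := exists_hessian_le_neg_sq hΩo hW hneg hK' hρΩ
  obtain ⟨L, hL⟩ := ContDiff.lipschitzWith_of_hasCompactSupport hfs hf one_ne_zero
  obtain ⟨B, hB⟩ := hf.continuous.bounded_above_of_compact_support hfs
  have hB0 : 0 ≤ B := (norm_nonneg _).trans (hB 0)
  refine ⟨K, hK, hKK'.trans hρΩ, fun η hη => ?_⟩
  obtain ⟨M, hM⟩ : ∃ M : ℝ, M = 2 * L / m := ⟨_, rfl⟩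
  have hM0 : 0 ≤ M := by rw [hM]; positivity
  obtain ⟨δ, hδ⟩ : ∃ δ, δ = η / (2 * (M ^ 2 + 1)) := ⟨_, rfl⟩
  obtain ⟨ω, hω⟩ : ∃ ω, ω = η / (4 * (M + 1)) := ⟨_, rfl⟩
  have hδ0 : 0 < δ := by rw [hδ]; positivity
  have hω0 : 0 < ω := by rw [hω]; positivity
  have hδM : δ * M ^ 2 ≤ η / 2 := by
    rw [hδ, div_mul_eq_mul_div, div_le_div_iff₀ (by positivity) (by positivity)]
    nlinarith
  have hωM : 2 * ω * M ≤ η / 2 := by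
    have : ω * (4 * (M + 1)) = η := by rw [hω]; field_simp
    linarith
  obtain ⟨r₁, hr₁, hH⟩ := Metric.uniformContinuousOn_iff.1
    (hK'.uniformContinuousOn_of_continuous ((continuousOn_fderiv_gradient hΩo hW).mono hρΩ)) δ hδ0
  obtain ⟨r₂, hr₂, hf'⟩ := Metric.uniformContinuous_iff.1
    ((hfs.fderiv ℝ).uniformContinuous_of_continuous (hf.continuous_fderiv one_ne_zero)) ω hω0
  obtain ⟨r, hr, hrρ, hrr₁, hrr₂⟩ : ∃ r > 0, r ≤ ρ / 2 ∧ r ≤ r₁ ∧ r ≤ r₂ :=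
    ⟨min (ρ / 2) (min r₁ r₂), by positivity, min_le_left _ _,
      (min_le_right _ _).trans (min_le_left _ _), (min_le_right _ _).trans (min_le_right _ _)⟩
  refine ⟨m * r ^ 2 / (4 * (B + 1)), by positivity, fun ε hε x hx z hz => ?_⟩
  have hqz := hq z hz (gradient f z)
  have hind : 0 ≤ K.indicator (fun _ => η) z := indicator_nonneg (fun _ _ => hη.le) z
  have hrhs : 0 ≤ ε ^ 2 / 2 * (⟪Ring.inverse (-fderiv ℝ (gradient W) z) (gradient f z),
      gradient f z⟫ + K.indicator (fun _ => η) z) := by positivity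
  have far : r ≤ ‖x - z‖ → z ∈ K ∨ x ∈ K → W x + ε * (f x - f z) ≤
      W z + ⟪gradient W z, x - z⟫ := by
    intro h1 h2
    have := le_tangent_sub_sq_of_far hΩo hΩ hW hneg hr hρΩ
      (fun y hy => (Metric.closedBall_subset_closedBall hrρ).trans (hball y hy)) hm hx hz h1 h2
    have h3 : |f x - f z| ≤ 2 * (B + 1) := by
      have := abs_sub (f x) (f z)
      have h4 := hB x
      have h5 := hB z
      simp only [Real.norm_eq_abs] at h4 h5
      linarith
    have h4 : ε * (f x - f z) ≤ m * r ^ 2 / 2 := by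
      calc ε * (f x - f z) ≤ |ε| * |f x - f z| := (le_abs_self _).trans (abs_mul _ _).le
        _ ≤ m * r ^ 2 / (4 * (B + 1)) * (2 * (B + 1)) := by gcongr
        _ = m * r ^ 2 / 2 := by field_simp; ring
    linarith
  by_cases hzK : z ∈ K
  swap
  · have hzS : z ∉ S := fun h => hzK (Metric.self_subset_cthickening S h)
    by_cases hxS : x ∈ S
    · have h1 : r ≤ ‖x - z‖ := by
        by_contra! h
        refine hzK (Metric.mem_cthickening_of_dist_le z x _ _ hxS ?_)
        rw [dist_eq_norm, norm_sub_rev]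
        linarith
      linarith [far h1 (Or.inr (Metric.self_subset_cthickening S hxS))]
    · have := le_tangent_of_hessian_nonpos hΩo hΩ hW hneg hx hz
      rw [image_eq_zero_of_notMem_tsupport hzS, image_eq_zero_of_notMem_tsupport hxS]
      linarith
  rcases le_or_gt r ‖x - z‖ with hxz | hxz
  · linarith [far hxz (Or.inl hzK)]
  have hseg : ∀ t ∈ Icc (0 : ℝ) 1, ‖t • (x - z)‖ < r := by
    intro t ht
    rw [norm_smul, Real.norm_of_nonneg ht.1]
    nlinarith [ht.2, norm_nonneg (x - z)]
  have hsegK : ∀ t ∈ Icc (0 : ℝ) 1, z + t • (x - z) ∈ K' := by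
    intro t ht
    refine hball z hzK ?_
    rw [mem_closedBall_iff_norm, add_sub_cancel_left]
    linarith [hseg t ht]
  have hsegW : ∀ t ∈ Icc (0 : ℝ) 1, ContDiffAt ℝ 2 W (z + t • (x - z)) := fun t ht =>
    hW.contDiffAt (hΩo.mem_nhds (hρΩ (hsegK t ht)))
  rcases le_or_gt (M * |ε|) ‖x - z‖ with hbig | hsmall
  · have h1 := le_tangent_sub_of_hessian_le (W := W) (z := z) (w := x - z)
      (k := m * ‖x - z‖ ^ 2) hsegW fun t ht => hm _ (hsegK t ht) _
    rw [add_sub_cancel] at h1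
    have h2 : ε * (f x - f z) ≤ |ε| * (L * ‖x - z‖) := by
      refine (le_abs_self _).trans ?_
      rw [abs_mul]
      have := hL.dist_le_mul x z
      rw [Real.dist_eq, dist_eq_norm] at this
      gcongr
    have h3 : |ε| * (L * ‖x - z‖) ≤ m * ‖x - z‖ ^ 2 / 2 := by
      have : 2 * L * |ε| ≤ m * ‖x - z‖ := by
        rw [hM, div_mul_eq_mul_div, div_le_iff₀ hm0] at hbig
        linarith
      nlinarith [norm_nonneg (x - z)]
    linarith
  · have h1 := le_tangent_sub_of_hessian_le (W := W) (z := z) (w := x - z)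
      (k := -⟪fderiv ℝ (gradient W) z (x - z), x - z⟫ - δ * ‖x - z‖ ^ 2) hsegW (by
        intro t ht
        have hd := hH _ (hsegK t ht) z (hKK' hzK) (by
          rw [dist_eq_norm, add_sub_cancel_left]
          exact (hseg t ht).trans_le hrr₁)
        rw [dist_eq_norm] at hd
        have h2 : ⟪(fderiv ℝ (gradient W) (z + t • (x - z)) - fderiv ℝ (gradient W) z) (x - z),
            x - z⟫ ≤ δ * ‖x - z‖ ^ 2 := by
          refine (real_inner_le_norm _ _).trans ?_
          rw [sq, ← mul_assoc]
          gcongr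
          exact (ContinuousLinearMap.le_opNorm _ _).trans (by gcongr)
        rw [sub_apply, inner_sub_left] at h2
        linarith)
    rw [add_sub_cancel] at h1
    have h2 : |f x - f z - ⟪gradient f z, x - z⟫| ≤ ω * ‖x - z‖ := by
      rw [inner_gradient_left]
      refine Convex.norm_image_sub_le_of_norm_hasFDerivWithin_le' (s := Metric.ball z r)
        (fun y _ => ((hf.differentiable one_ne_zero) y).hasFDerivAt.hasFDerivWithinAt) ?_
        (convex_ball z r) (Metric.mem_ball_self hr) (by rwa [mem_ball_iff_norm])
      intro y hy
      rw [← dist_eq_norm]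
      exact (hf' (lt_of_lt_of_le hy hrr₂)).le
    have h3 : ε * (f x - f z) ≤ ε * ⟪gradient f z, x - z⟫ + |ε| * (ω * ‖x - z‖) := by
      have : ε * (f x - f z - ⟪gradient f z, x - z⟫) ≤ |ε| * (ω * ‖x - z‖) := by
        refine (le_abs_self _).trans ?_
        rw [abs_mul]
        gcongr
      linarith
    have h4 := young z hz (ε • gradient f z) (x - z)
    simp only [map_smul, inner_smul_left, inner_smul_right, conj_trivial] at h4
    rw [indicator_of_mem hzK]
    have h5 : |ε| * (ω * ‖x - z‖) ≤ ω * M * ε ^ 2 := by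
      rw [← sq_abs ε]
      nlinarith [mul_le_mul_of_nonneg_left hsmall.le (mul_nonneg (abs_nonneg ε) hω0.le)]
    have h6 : δ * ‖x - z‖ ^ 2 ≤ δ * M ^ 2 * ε ^ 2 := by
      rw [← sq_abs ε, mul_assoc, ← mul_pow]
      gcongr
    have h7 := mul_le_mul_of_nonneg_right hδM (sq_nonneg ε)
    have h8 := mul_le_mul_of_nonneg_right hωM (sq_nonneg ε)
    linarith

end Hessian

section Scalar

theorem Real.eventually_quadratic_le_one_add_rpow {α κ : ℝ} (hκ : κ < α * (α - 1) / 2) :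
    ∀ᶠ t in 𝓝 (0 : ℝ), 1 + α * t + κ * t ^ 2 ≤ (1 + t) ^ α := by
  set φ : ℝ → ℝ := fun t => (1 + t) ^ α - (1 + α * t + κ * t ^ 2)
  have hpow : ∀ γ : ℝ, ∀ t : ℝ, 1 + t ≠ 0 →
      HasDerivAt (fun t : ℝ => (1 + t) ^ γ) (γ * (1 + t) ^ (γ - 1)) t := fun γ t ht => by
    simpa using ((hasDerivAt_id t).const_add 1).rpow_const (p := γ) (Or.inl ht)
  have h1 : ∀ t : ℝ, 1 + t ≠ 0 →
      HasDerivAt φ (α * (1 + t) ^ (α - 1) - (α + κ * (2 * t))) t := fun t ht => by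
    have h : HasDerivAt (fun t : ℝ => 1 + α * t + κ * t ^ 2) (α + κ * (2 * t)) t := by
      refine HasDerivAt.congr_deriv ((((hasDerivAt_id t).const_mul α).const_add 1).add
        (((hasDerivAt_id t).pow 2).const_mul κ)) ?_
      simp
    exact (hpow α t ht).sub h
  have hne : ∀ᶠ t in 𝓝 (0 : ℝ), 1 + t ≠ 0 := by
    have : ContinuousAt (fun t : ℝ => 1 + t) 0 := by fun_prop
    exact this.eventually_ne (by norm_num)
  have h2 : HasDerivAt (deriv φ) (α * (α - 1) - κ * 2) 0 := by
    have h : HasDerivAt (fun t : ℝ => α * (1 + t) ^ (α - 1) - (α + κ * (2 * t)))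
        (α * (α - 1) - κ * 2) 0 := by
      refine HasDerivAt.congr_deriv (((hpow (α - 1) 0 (by norm_num)).const_mul α).sub
        ((((hasDerivAt_id (0 : ℝ)).const_mul 2).const_mul κ).const_add α)) ?_
      simp
    refine h.congr_of_eventuallyEq ?_
    filter_upwards [hne] with t ht using (h1 t ht).deriv
  have hmin : IsLocalMin φ 0 := by
    refine isLocalMin_of_deriv_deriv_pos ?_ ?_ (h1 0 (by norm_num)).continuousAt
    · rw [h2.deriv]
      linarith
    · rw [(h1 0 (by norm_num)).deriv]
      simp
  filter_upwards [hmin] with t ht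
  simpa [φ] using ht

theorem Real.eventually_one_add_rpow_le {α α' : ℝ} (hα : α < α') :
    ∀ᶠ s in 𝓝[≥] (0 : ℝ), (1 + s) ^ α ≤ 1 + α' * s := by
  have h : HasDerivAt (fun t : ℝ => (1 + t) ^ α) α 0 := by
    simpa using ((hasDerivAt_id (0 : ℝ)).const_add 1).rpow_const (p := α) (Or.inl (by norm_num))
  have h1 := (hasDerivAt_iff_isLittleO.1 h).def (sub_pos.2 hα)
  filter_upwards [nhdsWithin_le_nhds h1, self_mem_nhdsWithin] with s hs hs0
  have h2 := (le_abs_self _).trans hs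
  have hs0' : 0 ≤ s := hs0
  simp only [sub_zero, add_zero, Real.one_rpow, smul_eq_mul, Real.norm_eq_abs,
    abs_of_nonneg hs0'] at h2
  linarith

theorem Real.max_add_rpow_eq {w : ℝ} (hw : 0 < w) (u β : ℝ) :
    max (w + u) 0 ^ (β + 1) = w * w ^ β * max (1 + u / w) 0 ^ (β + 1) := by
  have : max (w + u) 0 = w * max (1 + u / w) 0 := by
    rw [mul_max_of_nonneg _ _ hw.le, mul_zero, mul_add, mul_one, mul_div_cancel₀ _ hw.ne']
  rw [this, Real.mul_rpow hw.le (le_max_right _ _), Real.rpow_add_one hw.ne', mul_comm (w ^ β)]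

theorem Real.linear_le_max_add_rpow {w β : ℝ} (hw : 0 < w) (hβ : 0 ≤ β) (u : ℝ) :
    w * w ^ β + (β + 1) * u * w ^ β ≤ max (w + u) 0 ^ (β + 1) := by
  rw [Real.max_add_rpow_eq hw]
  have h : 1 + (β + 1) * (u / w) ≤ max (1 + u / w) 0 ^ (β + 1) := by
    rcases le_total (1 + u / w) 0 with h | h
    · rw [max_eq_right h, Real.zero_rpow (by positivity)]
      nlinarith
    · rw [max_eq_left h]
      exact one_add_mul_self_le_rpow_one_add (by linarith) (by linarith)
  calc w * w ^ β + (β + 1) * u * w ^ β = w * w ^ β * (1 + (β + 1) * (u / w)) := by field_simp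
    _ ≤ _ := by gcongr

end Scalar

theorem ofReal_integral_le_lintegral {X : Type*} [MeasurableSpace X] {μ : Measure X} {f : X → ℝ}
    (hf : Integrable f μ) : ENNReal.ofReal (∫ x, f x ∂μ) ≤ ∫⁻ x, ENNReal.ofReal (f x) ∂μ := by
  rw [integral_eq_lintegral_pos_part_sub_lintegral_neg_part hf]
  refine (ENNReal.ofReal_le_ofReal (sub_le_self _ ENNReal.toReal_nonneg)).trans ?_
  exact ENNReal.ofReal_toReal_le

theorem PrekopaLeindler.integral_le {E : Type*} [AddCommGroup E] [Module ℝ E] [MeasurableSpace E]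
    {μ : Measure E} (h : PrekopaLeindler μ) {A B C a b c : E → ℝ} (hA : Measurable A)
    (hB : Measurable B) (hC : Measurable C) (hA0 : ∀ x, 0 ≤ A x) (hC0 : ∀ x, 0 ≤ C x)
    (ha : Integrable a μ) (hb : Integrable b μ) (hc : Integrable c μ) (haA : ∀ x, a x ≤ A x)
    (hbB : ∀ x, b x ≤ B x) (hCc : ∀ x, C x ≤ c x) (hab : ∫ x, a x ∂μ = ∫ x, b x ∂μ)
    (hABC : ∀ x y, A x * B y ≤ C ((2⁻¹ : ℝ) • (x + y)) ^ 2) :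
    ∫ x, a x ∂μ ≤ ∫ x, c x ∂μ := by
  have key := h (fun x => .ofReal (A x)) (fun x => .ofReal (B x)) (fun x => .ofReal (C x))
    hA.ennreal_ofReal hB.ennreal_ofReal hC.ennreal_ofReal (fun x y => by
      rw [← ENNReal.ofReal_mul (hA0 x), ← ENNReal.ofReal_pow (hC0 _)]
      exact ENNReal.ofReal_le_ofReal (hABC x y))
  have hc0 : ∀ x, 0 ≤ c x := fun x => (hC0 x).trans (hCc x)
  have h1 : ENNReal.ofReal (∫ x, a x ∂μ) ≤ ∫⁻ x, .ofReal (A x) ∂μ :=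
    (ofReal_integral_le_lintegral ha).trans
      (lintegral_mono fun x => ENNReal.ofReal_le_ofReal (haA x))
  have h2 : ENNReal.ofReal (∫ x, a x ∂μ) ≤ ∫⁻ x, .ofReal (B x) ∂μ := by
    rw [hab]
    exact (ofReal_integral_le_lintegral hb).trans
      (lintegral_mono fun x => ENNReal.ofReal_le_ofReal (hbB x))
  have h3 : ∫⁻ x, .ofReal (C x) ∂μ ≤ ENNReal.ofReal (∫ x, c x ∂μ) := by
    rw [ofReal_integral_eq_lintegral_ofReal hc (Eventually.of_forall hc0)]
    exact lintegral_mono fun x => ENNReal.ofReal_le_ofReal (hCc x)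
  have h4 : ENNReal.ofReal (∫ x, a x ∂μ) ^ 2 ≤ ENNReal.ofReal (∫ x, c x ∂μ) ^ 2 := by
    calc _ = ENNReal.ofReal (∫ x, a x ∂μ) * ENNReal.ofReal (∫ x, a x ∂μ) := sq _
      _ ≤ _ := mul_le_mul' h1 h2
      _ ≤ _ := key
      _ ≤ _ := by gcongr
  exact (ENNReal.ofReal_le_ofReal_iff (integral_nonneg hc0)).1
    ((ENNReal.pow_le_pow_left_iff two_ne_zero).1 h4)

theorem PrekopaLeindler.mul_integral_le_of_tangent_bound {E : Type*} [NormedAddCommGroup E]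
    [InnerProductSpace ℝ E] [MeasurableSpace E] [BorelSpace E] {μ : Measure E}
    (h : PrekopaLeindler μ) {β b₀ q₀ : ℝ} (hβ : 0 < β) {W g q : E → ℝ} {p : E → E} {K : Set E}
    (hW0 : ∀ x, 0 ≤ W x) (hWm : Measurable W) (hWb : ∀ x, W x ≤ b₀)
    (hcvx : Convex ℝ {x | 0 < W x}) (hWc : ContinuousOn W {x | 0 < W x})
    (hnorm : ∫ x, W x ^ β ∂μ = 1) (hg : Continuous g) (hgs : HasCompactSupport g)
    (hgΩ : tsupport g ⊆ {x | 0 < W x}) (hgmean : ∫ x, g x * W x ^ β ∂μ = 0)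
    (hqm : Measurable q) (hq0 : ∀ x, 0 ≤ q x) (hqb : ∀ x, q x ≤ q₀)
    (hqs : ∀ x ∉ tsupport g, q x = 0) (hK : IsCompact K) (hKΩ : K ⊆ {x | 0 < W x})
    (htan : ∀ η > 0, ∃ ε₀ > 0, ∀ ε : ℝ, |ε| < ε₀ → ∀ x, 0 < W x → ∀ z, 0 < W z →
      W x + ε * (g x * W x - g z * W z) ≤ W z + ⟪p z, x - z⟫ +
        ε ^ 2 / 2 * (q z + K.indicator (fun _ => η) z)) :
    β * ∫ x, g x ^ 2 * W x * W x ^ β ∂μ ≤ ∫ x, q x * W x ^ β ∂μ := by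
  have hP0 : ∀ x, 0 ≤ W x ^ β := fun x => Real.rpow_nonneg (hW0 x) β
  have hP : Integrable (fun x => W x ^ β) μ := by
    by_contra hP
    rw [integral_undef hP] at hnorm
    exact zero_ne_one hnorm
  have hbdd : ∀ {φ : E → ℝ} (C : ℝ), Measurable φ → (∀ x, |φ x| ≤ C) →
      Integrable (fun x => φ x * W x ^ β) μ := fun C hφ hC =>
    hP.bdd_mul hφ.aestronglyMeasurable (Eventually.of_forall hC)
  obtain ⟨g₀, hg₀⟩ := hg.bounded_above_of_compact_support hgs
  simp only [Real.norm_eq_abs] at hg₀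
  have hg₀0 : 0 ≤ g₀ := (abs_nonneg _).trans (hg₀ 0)
  have hWb' : ∀ x, |W x| ≤ b₀ := fun x => by rw [abs_of_nonneg (hW0 x)]; exact hWb x
  have hgm := hg.measurable
  have hintW : Integrable (fun x => W x * W x ^ β) μ := hbdd b₀ hWm hWb'
  have hintg : Integrable (fun x => g x * W x ^ β) μ := hbdd g₀ hgm hg₀
  have hintf : Integrable (fun x => g x * W x * W x ^ β) μ :=
    hbdd (g₀ * b₀) (hgm.mul hWm) fun x => by
      rw [abs_mul]
      exact mul_le_mul (hg₀ x) (hWb' x) (abs_nonneg _) hg₀0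
  have hintJ : Integrable (fun x => g x ^ 2 * W x * W x ^ β) μ :=
    hbdd (g₀ ^ 2 * b₀) ((hgm.pow_const 2).mul hWm) fun x => by
      rw [abs_mul, abs_pow]
      exact mul_le_mul (pow_le_pow_left₀ (abs_nonneg _) (hg₀ x) 2) (hWb' x) (abs_nonneg _)
        (by positivity)
  have hintq : Integrable (fun x => q x * W x ^ β) μ :=
    hbdd q₀ hqm fun x => by rw [abs_of_nonneg (hq0 x)]; exact hqb x
  obtain ⟨k, hk⟩ : ∃ k : E → ℝ, k = K.indicator fun _ => 1 := ⟨_, rfl⟩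
  have hk0 : ∀ x, 0 ≤ k x := fun x => hk ▸ indicator_nonneg (fun _ _ => zero_le_one) x
  have hk1 : ∀ x, k x ≤ 1 := fun x => hk ▸ indicator_le_self' (fun _ _ => zero_le_one) x
  have hks : ∀ x ∉ K, k x = 0 := fun x hx => by rw [hk, indicator_of_notMem hx]
  have hkm : Measurable k := hk ▸ measurable_const.indicator hK.measurableSet
  have hkη : ∀ η x, K.indicator (fun _ => η) x = η * k x := fun η x => by
    rw [hk]
    by_cases hx : x ∈ K <;> simp [hx]
  have hintk : Integrable (fun x => k x * W x ^ β) μ :=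
    hbdd 1 hkm fun x => by rw [abs_of_nonneg (hk0 x)]; exact hk1 x
  obtain ⟨c, hc⟩ : ∃ c, c = -∫ x, g x * W x * W x ^ β ∂μ := ⟨_, rfl⟩
  obtain ⟨w₀, hw₀, hw₀T⟩ := (hgs.isCompact.union hK).exists_forall_le'
    (hWc.mono (union_subset hgΩ hKΩ)) (a := 0) (union_subset hgΩ hKΩ)
  have key : ∀ δ > 0, δ ≤ (β + 1) * β / 2 →
      ((β + 1) * β / 2 - δ) * ∫ x, g x ^ 2 * W x * W x ^ β ∂μ ≤
        (β + 1 + δ) / 2 * (∫ x, q x * W x ^ β ∂μ + δ * ∫ x, k x * W x ^ β ∂μ) := by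
    intro δ hδ hδβ
    obtain ⟨κ, hκ⟩ : ∃ κ, κ = (β + 1) * β / 2 - δ := ⟨_, rfl⟩
    have hκ0 : 0 ≤ κ := by linarith
    rw [← hκ]
    obtain ⟨ε₀, hε₀, htanδ⟩ := htan δ hδ
    obtain ⟨t₀, ht₀, hquad⟩ := Metric.eventually_nhds_iff.1
      (Real.eventually_quadratic_le_one_add_rpow (α := β + 1) (κ := κ) (by
        rw [hκ, add_sub_cancel_right]
        linarith))
    obtain ⟨s₀, hs₀, hlin⟩ := Metric.eventually_nhds_iff.1 (eventually_nhdsWithin_iff.1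
      (Real.eventually_one_add_rpow_le (lt_add_of_pos_right (β + 1) hδ)))
    simp only [dist_zero_right, Real.norm_eq_abs] at hquad hlin
    obtain ⟨ε, hε, hεε₀, hεt₀, hεs₀⟩ : ∃ ε > 0, ε < ε₀ ∧ ε * (g₀ + |c| / w₀) < min t₀ 1 ∧
        ε ^ 2 / 2 * ((q₀ + δ) / w₀) < s₀ := by
      have h1 : ∀ᶠ ε in 𝓝 (0 : ℝ), ε < ε₀ ∧ ε * (g₀ + |c| / w₀) < min t₀ 1 ∧
          ε ^ 2 / 2 * ((q₀ + δ) / w₀) < s₀ := by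
        refine (eventually_lt_nhds hε₀).and (.and ?_ ?_)
        · exact Tendsto.eventually_lt_const (u := min t₀ 1) (v := 0) (by positivity)
            (Continuous.tendsto' (by fun_prop) _ _ (by simp))
        · exact Tendsto.eventually_lt_const (u := s₀) (v := 0) hs₀
            (Continuous.tendsto' (by fun_prop) _ _ (by simp))
      have h2 : ∀ᶠ ε in 𝓝[>] (0 : ℝ), 0 < ε := self_mem_nhdsWithin
      exact (h2.and (nhdsWithin_le_nhds h1)).exists
    obtain ⟨a, ha⟩ : ∃ a : ℝ → E → ℝ, a = fun τ x => W x * W x ^ β +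
      ((β + 1) * τ * (g x * W x * W x ^ β) + (β + 1) * τ * c * W x ^ β) +
      (κ * τ ^ 2 * (g x ^ 2 * W x * W x ^ β) + κ * τ ^ 2 * (2 * c) * (g x * W x ^ β)) := ⟨_, rfl⟩
    have hai : ∀ τ, Integrable (a τ) μ := fun τ => by
      rw [ha]
      exact (hintW.add ((hintf.const_mul _).add (hP.const_mul _))).add
        ((hintJ.const_mul _).add (hintg.const_mul _))
    have haI : ∀ τ, ∫ x, a τ x ∂μ = ∫ x, W x * W x ^ β ∂μ +
        κ * τ ^ 2 * ∫ x, g x ^ 2 * W x * W x ^ β ∂μ := fun τ => by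
      rw [ha, integral_add, integral_add, integral_add, integral_add, integral_const_mul,
        integral_const_mul, integral_const_mul, integral_const_mul, hgmean, hnorm, hc]
      · ring
      all_goals first
        | exact hintJ.const_mul _
        | exact hintg.const_mul _
        | exact hintf.const_mul _
        | exact hP.const_mul _
        | exact hintW
        | exact (hintJ.const_mul _).add (hintg.const_mul _)
        | exact (hintf.const_mul _).add (hP.const_mul _)
        | exact hintW.add ((hintf.const_mul _).add (hP.const_mul _))
    obtain ⟨A, hA⟩ : ∃ A : ℝ → E → ℝ, A = fun τ => {x | 0 < W x}.indicator
      fun x => max (W x + τ * (g x * W x + c)) 0 ^ (β + 1) := ⟨_, rfl⟩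
    have hΩm : MeasurableSet {x | 0 < W x} := measurableSet_lt measurable_const hWm
    have hAm : ∀ τ, Measurable (A τ) := fun τ => by
      rw [hA]
      exact Measurable.indicator (by fun_prop) hΩm
    have hA0 : ∀ τ x, 0 ≤ A τ x := fun τ x => by
      rw [hA]
      exact indicator_nonneg (fun _ _ => by positivity) x
    have hPz : ∀ x, ¬ 0 < W x → W x ^ β = 0 := fun x hx => by
      rw [le_antisymm (not_lt.1 hx) (hW0 x), Real.zero_rpow hβ.ne']
    have haA : ∀ τ, |τ| = ε → ∀ x, a τ x ≤ A τ x := by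
      intro τ hτ x
      by_cases hx : 0 < W x
      swap
      · refine le_trans (le_of_eq ?_) (hA0 τ x)
        simp [ha, hPz x hx]
      simp only [ha, hA]
      rw [indicator_of_mem (by exact hx)]
      by_cases hxg : x ∈ tsupport g
      · have hwx : w₀ ≤ W x := hw₀T x (Or.inl hxg)
        have ht : |τ * (g x * W x + c) / W x| < min t₀ 1 := by
          refine lt_of_le_of_lt ?_ hεt₀
          rw [mul_div_assoc, abs_mul, hτ, add_div, mul_div_cancel_right₀ _ hx.ne']
          gcongr
          refine (abs_add_le _ _).trans (add_le_add (hg₀ x) ?_)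
          rw [abs_div, abs_of_pos hx]
          gcongr
        rw [Real.max_add_rpow_eq hx]
        have h0 : 0 ≤ 1 + τ * (g x * W x + c) / W x := by
          have := (abs_lt.1 (ht.trans_le (min_le_right _ _))).1
          linarith
        have h1 := hquad (ht.trans_le (min_le_left _ _))
        rw [max_eq_left h0]
        have h2 := mul_le_mul_of_nonneg_left h1 (mul_nonneg hx.le (hP0 x))
        refine le_trans ?_ h2
        have h3 : 0 ≤ κ * τ ^ 2 * c ^ 2 / W x * W x ^ β := by
          have := hP0 x
          positivity
        rw [← sub_nonneg]
        refine h3.trans_eq ?_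
        field_simp
        ring
      · have hgx : g x = 0 := image_eq_zero_of_notMem_tsupport hxg
        have := Real.linear_le_max_add_rpow hx hβ.le (τ * (g x * W x + c))
        refine le_trans (le_of_eq ?_) this
        simp only [hgx]
        ring
    obtain ⟨R, hR⟩ : ∃ R : E → ℝ, R = fun x => q x + δ * k x := ⟨_, rfl⟩
    have hR0 : ∀ x, 0 ≤ R x := fun x => by
      rw [hR]
      exact add_nonneg (hq0 x) (mul_nonneg hδ.le (hk0 x))
    have hRm : Measurable R := by
      rw [hR]
      fun_prop
    obtain ⟨C, hC⟩ : ∃ C : E → ℝ, C = {x | 0 < W x}.indicator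
      fun x => (W x + ε ^ 2 / 2 * R x) ^ (β + 1) := ⟨_, rfl⟩
    have hCm : Measurable C := by
      rw [hC]
      exact Measurable.indicator (by fun_prop) hΩm
    have hC0 : ∀ x, 0 ≤ C x := fun x => by
      rw [hC]
      refine indicator_nonneg (fun x _ => ?_) x
      have := hW0 x
      have := hR0 x
      positivity
    have hCc : ∀ x, C x ≤ W x * W x ^ β + (β + 1 + δ) * (ε ^ 2 / 2) *
        (q x * W x ^ β + δ * (k x * W x ^ β)) := by
      intro x
      rw [hC]
      by_cases hx : 0 < W x
      swap
      · rw [indicator_of_notMem (by exact hx)]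
        simp [hPz x hx]
      rw [indicator_of_mem (by exact hx)]
      have hs0 : 0 ≤ ε ^ 2 / 2 * R x / W x := by
        have := hR0 x
        positivity
      have hs : |ε ^ 2 / 2 * R x / W x| < s₀ := by
        rw [abs_of_nonneg hs0]
        by_cases hxT : x ∈ tsupport g ∪ K
        · refine lt_of_le_of_lt ?_ hεs₀
          rw [mul_div_assoc]
          have hwx : w₀ ≤ W x := hw₀T x hxT
          have hRx : R x ≤ q₀ + δ := by
            rw [hR]
            have := mul_le_mul_of_nonneg_left (hk1 x) hδ.le
            linarith [hqb x]
          have hqδ := (hR0 x).trans hRx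
          gcongr
        · have : R x = 0 := by
            rw [hR]
            simp [hqs x fun h => hxT (Or.inl h), hks x fun h => hxT (Or.inr h)]
          simpa [this] using hs₀
      have h1 := Real.max_add_rpow_eq hx (ε ^ 2 / 2 * R x) β
      rw [max_eq_left (by have := hR0 x; positivity), max_eq_left (by positivity)] at h1
      rw [h1]
      have h2 := mul_le_mul_of_nonneg_left (hlin hs hs0) (mul_nonneg hx.le (hP0 x))
      refine h2.trans_eq ?_
      rw [hR]
      field_simp
    have hci : Integrable (fun x => W x * W x ^ β + (β + 1 + δ) * (ε ^ 2 / 2) *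
        (q x * W x ^ β + δ * (k x * W x ^ β))) μ :=
      hintW.add ((hintq.add (hintk.const_mul _)).const_mul _)
    have hcI : ∫ x, (W x * W x ^ β + (β + 1 + δ) * (ε ^ 2 / 2) *
        (q x * W x ^ β + δ * (k x * W x ^ β))) ∂μ = ∫ x, W x * W x ^ β ∂μ +
        (β + 1 + δ) * (ε ^ 2 / 2) *
          (∫ x, q x * W x ^ β ∂μ + δ * ∫ x, k x * W x ^ β ∂μ) := by
      rw [integral_add hintW, integral_const_mul, integral_add hintq (hintk.const_mul _),
        integral_const_mul]
      exact (hintq.add (hintk.const_mul _)).const_mul _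
    have hAC : ∀ x y, A ε x * A (-ε) y ≤ C ((2⁻¹ : ℝ) • (x + y)) ^ 2 := by
      intro x y
      by_cases hxy : 0 < W x ∧ 0 < W y
      swap
      · refine le_trans (le_of_eq ?_) (sq_nonneg _)
        rw [not_and_or] at hxy
        rw [hA]
        rcases hxy with h | h
        · dsimp only
          rw [indicator_of_notMem (by exact h), zero_mul]
        · dsimp only
          rw [indicator_of_notMem (a := y) (by exact h), mul_zero]
      obtain ⟨hx, hy⟩ := hxy
      obtain ⟨z, hz⟩ : ∃ z : E, z = (2⁻¹ : ℝ) • (x + y) := ⟨_, rfl⟩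
      have hzΩ : 0 < W z := by
        rw [hz, smul_add]
        exact hcvx hx hy (by norm_num) (by norm_num) (by norm_num)
      rw [← hz, hA, hC]
      dsimp only
      rw [indicator_of_mem (by exact hx), indicator_of_mem (a := y) (by exact hy),
        indicator_of_mem (by exact hzΩ), ← Real.mul_rpow (le_max_right _ _) (le_max_right _ _)]
      have hm0 : 0 ≤ W z + ε ^ 2 / 2 * R z := by
        have := hR0 z
        positivity
      rw [← Real.rpow_natCast, ← Real.rpow_mul hm0, mul_comm (β + 1), Real.rpow_mul hm0,
        Real.rpow_natCast]
      refine Real.rpow_le_rpow (mul_nonneg (le_max_right _ _) (le_max_right _ _)) ?_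
        (by positivity)
      rcases le_total (W x + ε * (g x * W x + c)) 0 with h1 | h1
      · rw [max_eq_right h1, zero_mul]
        positivity
      rcases le_total (W y + -ε * (g y * W y + c)) 0 with h2 | h2
      · rw [max_eq_right h2, mul_zero]
        positivity
      rw [max_eq_left h1, max_eq_left h2]
      have h3 := htanδ ε (by rwa [abs_of_pos hε]) x hx z hzΩ
      have h4 := htanδ (-ε) (by rwa [abs_neg, abs_of_pos hε]) y hy z hzΩ
      have h5 : ⟪p z, x - z⟫ + ⟪p z, y - z⟫ = 0 := by
        rw [← inner_add_right, show x - z + (y - z) = 0 by rw [hz]; module, inner_zero_right]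
      have h6 : R z = q z + K.indicator (fun _ => δ) z := by rw [hR, hkη]
      rw [neg_sq] at h4
      rw [← h6] at h3 h4
      nlinarith [sq_nonneg (W x + ε * (g x * W x + c) - (W y + -ε * (g y * W y + c)))]
    have hfin := h.integral_le (hAm ε) (hAm (-ε)) hCm (hA0 ε) hC0 (hai ε) (hai (-ε)) hci
      (haA ε (abs_of_pos hε)) (haA (-ε) (by rw [abs_neg, abs_of_pos hε])) hCc
      (by rw [haI, haI, neg_sq]) hAC
    rw [haI, hcI] at hfin
    have hε2 : 0 < ε ^ 2 := by positivity
    refine le_of_mul_le_mul_left ?_ hε2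
    linarith
  have hev : ∀ᶠ δ in 𝓝[>] (0 : ℝ),
      ((β + 1) * β / 2 - δ) * ∫ x, g x ^ 2 * W x * W x ^ β ∂μ ≤
        (β + 1 + δ) / 2 * (∫ x, q x * W x ^ β ∂μ + δ * ∫ x, k x * W x ^ β ∂μ) := by
    filter_upwards [self_mem_nhdsWithin,
      nhdsWithin_le_nhds (eventually_le_nhds (show 0 < (β + 1) * β / 2 by positivity))]
      with δ h1 h2 using key δ h1 h2
  have hlim := le_of_tendsto_of_tendsto
    (tendsto_nhdsWithin_of_tendsto_nhds (Continuous.tendsto (by fun_prop) (0 : ℝ)))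
    (tendsto_nhdsWithin_of_tendsto_nhds (Continuous.tendsto (by fun_prop) (0 : ℝ))) hev
  refine le_of_mul_le_mul_left ?_ (show 0 < (β + 1) / 2 by positivity)
  linarith

theorem continuous_of_continuousOn_of_eqOn_compl {X Y : Type*} [TopologicalSpace X]
    [TopologicalSpace Y] {Ω S : Set X} {f : X → Y} {y : Y} (hΩ : IsOpen Ω) (hS : IsClosed S)
    (hSΩ : S ⊆ Ω) (hf : ContinuousOn f Ω) (hf' : ∀ x ∉ S, f x = y) : Continuous f := by
  rw [continuous_iff_continuousAt]
  intro x
  by_cases hx : x ∈ S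
  · exact hf.continuousAt (hΩ.mem_nhds (hSΩ hx))
  · refine continuousAt_const.congr (f := fun _ => y) ?_
    filter_upwards [hS.isOpen_compl.mem_nhds hx] with z hz using (hf' z hz).symm

theorem gradient_eq_zero_of_notMem_tsupport {E : Type*} [NormedAddCommGroup E]
    [InnerProductSpace ℝ E] [CompleteSpace E] {f : E → ℝ} {x : E} (hx : x ∉ tsupport f) :
    gradient f x = 0 := by
  have : fderiv ℝ f x = 0 :=
    image_eq_zero_of_notMem_tsupport fun h => hx (tsupport_fderiv_subset ℝ h)
  rw [gradient, this, map_zero]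

theorem exists_forall_le_of_hessian_neg {E : Type*} [NormedAddCommGroup E]
    [InnerProductSpace ℝ E] [CompleteSpace E] {Ω : Set E} {W : E → ℝ} (hΩo : IsOpen Ω)
    (hΩ : Convex ℝ Ω) (hΩb : Bornology.IsBounded Ω) (hW : ContDiffOn ℝ 2 W Ω)
    (hneg : ∀ x ∈ Ω, ∀ v : E, v ≠ 0 → ⟪fderiv ℝ (gradient W) x v, v⟫ < 0) :
    ∃ b, 0 ≤ b ∧ ∀ x ∈ Ω, W x ≤ b := by
  rcases Ω.eq_empty_or_nonempty with rfl | ⟨z, hz⟩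
  · exact ⟨0, le_rfl, by simp⟩
  obtain ⟨r, hr⟩ := hΩb.subset_closedBall z
  refine ⟨max (W z + ‖gradient W z‖ * r) 0, le_max_right _ _, fun x hx => le_max_of_le_left ?_⟩
  have h1 := le_tangent_of_hessian_nonpos hΩo hΩ hW hneg hx hz
  have h2 := real_inner_le_norm (gradient W z) (x - z)
  have h3 := mul_le_mul_of_nonneg_left (mem_closedBall_iff_norm.1 (hr hx))
    (norm_nonneg (gradient W z))
  linarith

theorem PrekopaLeindler.brascampLieb {E : Type*} [NormedAddCommGroup E]
    [InnerProductSpace ℝ E] [FiniteDimensional ℝ E] [MeasurableSpace E] [BorelSpace E]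
    {μ : Measure E} (h : PrekopaLeindler μ) {β : ℝ} (hβ : 0 < β) {W g : E → ℝ}
    (hW0 : ∀ x, 0 ≤ W x) (hopen : IsOpen {x | 0 < W x})
    (hbd : Bornology.IsBounded {x | 0 < W x}) (hcvx : Convex ℝ {x | 0 < W x})
    (hC2 : ContDiffOn ℝ 2 W {x | 0 < W x}) (hnorm : ∫ x, W x ^ β ∂μ = 1)
    (hhess : ∀ x ∈ {x | 0 < W x}, ∀ v : E, v ≠ 0 → ⟪fderiv ℝ (gradient W) x v, v⟫ < 0)
    (hg : ContDiff ℝ 1 g) (hgsupp : HasCompactSupport g) (hgΩ : tsupport g ⊆ {x | 0 < W x})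
    (hgmean : ∫ x, g x * W x ^ β ∂μ = 0) :
    β * ∫ x, g x ^ 2 * W x * W x ^ β ∂μ ≤
      ∫ x, ⟪Ring.inverse (-fderiv ℝ (gradient W) x) (gradient (fun y => g y * W y) x),
        gradient (fun y => g y * W y) x⟫ * W x ^ β ∂μ := by
  obtain ⟨f, hf⟩ : ∃ f, f = fun y => g y * W y := ⟨_, rfl⟩
  rw [← hf]
  have hfg : tsupport f ⊆ tsupport g := by
    rw [hf]
    exact tsupport_mul_subset_left
  have hfs : HasCompactSupport f := hgsupp.mono' ((subset_tsupport f).trans hfg)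
  have hf1 : ContDiff ℝ 1 f := by
    rw [contDiff_iff_contDiffAt]
    intro x
    by_cases hx : x ∈ tsupport f
    · rw [hf]
      exact hg.contDiffAt.mul
        ((hC2.contDiffAt (hopen.mem_nhds (hgΩ (hfg hx)))).of_le (by norm_num))
    · exact contDiffAt_const.congr_of_eventuallyEq (notMem_tsupport_iff_eventuallyEq.1 hx)
  have hpos : ∀ x ∈ {x | 0 < W x}, ∀ v : E, v ≠ 0 →
      0 < ⟪(-fderiv ℝ (gradient W) x) v, v⟫ := fun x hx v hv => by simpa using hhess x hx v hv
  obtain ⟨q, hq⟩ : ∃ q : E → ℝ, q = fun x =>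
      ⟪Ring.inverse (-fderiv ℝ (gradient W) x) (gradient f x), gradient f x⟫ := ⟨_, rfl⟩
  have hqs : ∀ x ∉ tsupport g, q x = 0 := fun x hx => by
    simp [hq, gradient_eq_zero_of_notMem_tsupport fun h => hx (hfg h)]
  have hqc : Continuous q := by
    refine continuous_of_continuousOn_of_eqOn_compl hopen (isClosed_tsupport g) hgΩ ?_ hqs
    have h1 : ContinuousOn (fun x => Ring.inverse (-fderiv ℝ (gradient W) x))
        {x | 0 < W x} := fun x hx => by
      obtain ⟨u, hu⟩ := isUnit_of_inner_pos (hpos x hx)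
      have h2 := NormedRing.inverse_continuousAt u
      rw [hu] at h2
      exact ContinuousAt.comp_continuousWithinAt (f := fun x => -fderiv ℝ (gradient W) x) h2
        ((continuousOn_fderiv_gradient hopen hC2).neg x hx)
    have h3 : Continuous (gradient f) :=
      (InnerProductSpace.toDual ℝ E).symm.continuous.comp (hf1.continuous_fderiv one_ne_zero)
    rw [hq]
    exact (h1.clm_apply h3.continuousOn).inner h3.continuousOn
  have hq0 : ∀ x, 0 ≤ q x := fun x => by
    by_cases hx : 0 < W x
    · have := two_mul_inner_sub_le_inner_inverse (hpos x hx) (fun v w => by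
        simpa using inner_fderiv_gradient_comm (hC2.contDiffAt (hopen.mem_nhds hx)) v w)
        (gradient f x) 0
      simpa [hq] using this
    · exact (hqs x fun h => hx (hgΩ h)).ge
  obtain ⟨q₀, hq₀⟩ := hqc.bounded_above_of_compact_support
    (HasCompactSupport.intro hgsupp.isCompact hqs)
  obtain ⟨b, hb0, hb⟩ := exists_forall_le_of_hessian_neg hopen hcvx hbd hC2 hhess
  have hWz : ∀ x, ¬ 0 < W x → W x = 0 := fun x hx => le_antisymm (not_lt.1 hx) (hW0 x)
  have hWm : Measurable W := by
    classical
    have h1 := hC2.continuousOn.measurable_piecewise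
      (continuousOn_const (c := (0 : ℝ)) (s := {x | 0 < W x}ᶜ)) hopen.measurableSet
    convert h1 using 1
    ext x
    by_cases hx : x ∈ {x | 0 < W x}
    · rw [piecewise_eq_of_mem _ _ _ hx]
    · rw [piecewise_eq_of_notMem _ _ _ hx, hWz x hx]
  obtain ⟨K, hK, hKΩ, htan⟩ := exists_perturbed_tangent_bound hopen hcvx hC2 hhess hf1 hfs
    (hfg.trans hgΩ)
  have := h.mul_integral_le_of_tangent_bound (q := q) (p := gradient W) hβ hW0 hWm
    (fun x => (em (0 < W x)).elim (hb x) fun hx => (hWz x hx).trans_le hb0) hcvx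
    hC2.continuousOn hnorm hg.continuous hgsupp hgΩ hgmean hqc.measurable hq0
    (fun x => (le_abs_self _).trans (hq₀ x)) hqs hK hKΩ fun η hη => by
      obtain ⟨ε₀, hε₀, H⟩ := htan η hη
      refine ⟨ε₀, hε₀, fun ε hε x hx z hz => ?_⟩
      have := H ε hε x hx z hz
      simpa only [hf, hq] using this
  simpa only [hq] using this

end BrascampLieb

/-- dimensional Brascamp–Lieb, Case 1: for `β > 0`, `W ≥ 0` concave on
its bounded open convex support `Ω = {W > 0}`, `C²` on `Ω` with `∫ W^β = 1` and
`D²W < 0` on `Ω`, every `C¹` function `g` compactly supported in `Ω` with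
`∫ g W^β = 0` satisfies, for `f = g W`,
`∫ ⟨(-D²W)⁻¹ ∇f, ∇f⟩ W^β ≥ β ∫ g² W W^β`.
The Hessian is `D²W x = fderiv ℝ (gradient W) x`, and the inverse of the corresponding
continuous linear map is taken in the ring of endomorphisms. -/
theorem dimensional_brascamp_lieb_case1
    (n : ℕ) (hn : 1 ≤ n) (β : ℝ) (hβ : 0 < β)
    (W : EuclideanSpace ℝ (Fin n) → ℝ) (hW0 : ∀ x, 0 ≤ W x)
    (hconc : ConcaveOn ℝ {x | 0 < W x} W) (hopen : IsOpen {x | 0 < W x})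
    (hbd : Bornology.IsBounded {x | 0 < W x}) (hcvx : Convex ℝ {x | 0 < W x})
    (hC2 : ContDiffOn ℝ 2 W {x | 0 < W x})
    (hnorm : (∫ x, W x ^ β) = 1)
    (hhess : ∀ x ∈ {x | 0 < W x}, ∀ v : EuclideanSpace ℝ (Fin n), v ≠ 0 →
      ⟪fderiv ℝ (gradient W) x v, v⟫ < 0)
    (g : EuclideanSpace ℝ (Fin n) → ℝ) (hg : ContDiff ℝ 1 g)
    (hgsupp : HasCompactSupport g) (hgΩ : tsupport g ⊆ {x | 0 < W x})
    (hgmean : (∫ x, g x * W x ^ β) = 0) :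
    (∫ x, ⟪Ring.inverse (-(fderiv ℝ (gradient W) x))
        (gradient (fun y => g y * W y) x), gradient (fun y => g y * W y) x⟫ * W x ^ β) ≥
      β * ∫ x, g x ^ 2 * W x * W x ^ β := by
  exact (prekopaLeindler_euclideanSpace n).brascampLieb hβ hW0 hopen hbd hcvx hC2 hnorm hhess hg
    hgsupp hgΩ hgmean
end
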